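/- arXiv:1905.12800 — 5 statements merged into one kernel-verified Lean document; each statement's English description precedes it below -/
import Mathlib

section
/- Let G and H be real Hilbert spaces and let E : G → H be a bounded linear operator that admits a bounded right inverse Ê : H → G, i.e. E(Ê v) = v for all v ∈ H. Then the operator E ∘ E† : H → H is bijective, and for every v ∈ H one has ‖Ê‖⁻² · ‖v‖² ≤ ⟪v, E(E† v)⟫ = ‖E† v‖² ≤ ‖E‖² · ‖v‖². -/
open scoped InnerProductSpace

open ContinuousLinearMap in
/-- The adjoint of an operator with a bounded right inverse is bounded below. -/
theorem norm_le_opNorm_mul_norm_adjoint_of_rightInverse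
    {G H : Type*}
    [NormedAddCommGroup G] [InnerProductSpace ℝ G] [CompleteSpace G]
    [NormedAddCommGroup H] [InnerProductSpace ℝ H] [CompleteSpace H]
    {E : G →L[ℝ] H} {Ehat : H →L[ℝ] G} (hright : ∀ v : H, E (Ehat v) = v) (v : H) :
    ‖v‖ ≤ ‖Ehat‖ * ‖adjoint E v‖ := by
  have h : adjoint Ehat (adjoint E v) = v :=
    ext_inner_right ℝ fun w => by rw [adjoint_inner_left, adjoint_inner_left, hright]
  calc ‖v‖ = ‖adjoint Ehat (adjoint E v)‖ := by rw [h]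
    _ ≤ ‖adjoint Ehat‖ * ‖adjoint E v‖ := le_opNorm _ _
    _ = ‖Ehat‖ * ‖adjoint E v‖ := by rw [LinearIsometryEquiv.norm_map]

open ContinuousLinearMap in
theorem inner_apply_adjoint_self
    {G H : Type*}
    [NormedAddCommGroup G] [InnerProductSpace ℝ G] [CompleteSpace G]
    [NormedAddCommGroup H] [InnerProductSpace ℝ H] [CompleteSpace H]
    (E : G →L[ℝ] H) (v : H) :
    ⟪v, E (adjoint E v)⟫_ℝ = ‖adjoint E v‖ ^ 2 := by
  rw [← adjoint_inner_left, real_inner_self_eq_norm_sq]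

/-- If a bounded operator `E : G → H` between real Hilbert spaces admits a
bounded right inverse `Ê`, then `E ∘ E†` is bijective and
`‖Ê‖⁻² ‖v‖² ≤ ⟪v, E (E† v)⟫ = ‖E† v‖² ≤ ‖E‖² ‖v‖²` for every `v`. -/
theorem stmt0
    {G H : Type*}
    [NormedAddCommGroup G] [InnerProductSpace ℝ G] [CompleteSpace G]
    [NormedAddCommGroup H] [InnerProductSpace ℝ H] [CompleteSpace H]
    (E : G →L[ℝ] H) (Ehat : H →L[ℝ] G)
    (hright : ∀ v : H, E (Ehat v) = v) :
    Function.Bijective (fun v : H => E (ContinuousLinearMap.adjoint E v)) ∧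
      ∀ v : H,
        ‖Ehat‖⁻¹ ^ 2 * ‖v‖ ^ 2 ≤ ⟪v, E (ContinuousLinearMap.adjoint E v)⟫_ℝ ∧
        ⟪v, E (ContinuousLinearMap.adjoint E v)⟫_ℝ = ‖ContinuousLinearMap.adjoint E v‖ ^ 2 ∧
        ‖ContinuousLinearMap.adjoint E v‖ ^ 2 ≤ ‖E‖ ^ 2 * ‖v‖ ^ 2 := by
  have hbelow := norm_le_opNorm_mul_norm_adjoint_of_rightInverse hright
  have hinner := inner_apply_adjoint_self E
  refine ⟨?_, fun v => ⟨?_, hinner v, ?_⟩⟩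
  · have hunit : IsUnit (E ∘L ContinuousLinearMap.adjoint E) := by
      refine ContinuousLinearMap.isUnit_of_forall_le_norm_inner_map _
        (c := (‖Ehat‖₊ + 1)⁻¹ ^ 2) (by positivity) fun v => ?_
      have hv : (‖Ehat‖ + 1)⁻¹ * ‖v‖ ≤ ‖ContinuousLinearMap.adjoint E v‖ := by
        rw [inv_mul_le_iff₀ (by positivity)]
        exact (hbelow v).trans (by gcongr; linarith)
      rw [ContinuousLinearMap.comp_apply, real_inner_comm, hinner,
        Real.norm_of_nonneg (by positivity)]
      calc _ = ((‖Ehat‖ + 1)⁻¹ * ‖v‖) ^ 2 := by push_cast; ring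
        _ ≤ _ := by gcongr
    exact ContinuousLinearMap.isUnit_iff_bijective.mp hunit
  · rw [hinner, ← mul_pow]
    gcongr
    exact inv_mul_le_of_le_mul₀ (norm_nonneg _) (norm_nonneg _) (hbelow v)
  · rw [← mul_pow]
    gcongr
    simpa using (ContinuousLinearMap.adjoint E).le_opNorm v
end

section
/- Let G and H be real Hilbert spaces and E : G → H a bounded linear operator with a bounded right inverse Ê : H → G (E ∘ Ê = id_H). Then E ∘ E† : H → H is bijective and its condition number satisfies ‖E ∘ E†‖ · ‖(E ∘ E†)⁻¹‖ ≤ ‖E‖² · ‖Ê‖². -/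
section RightInverse

variable {G H : Type*}
  [NormedAddCommGroup G] [InnerProductSpace ℝ G] [CompleteSpace G]
  [NormedAddCommGroup H] [InnerProductSpace ℝ H] [CompleteSpace H]
  {E : G →L[ℝ] H} {Ehat : H →L[ℝ] G}

/-- If `E` has a bounded right inverse, then its adjoint is bounded below. -/
lemma norm_le_mul_norm_adjoint_of_rightInverse (hright : ∀ v : H, E (Ehat v) = v) (v : H) :
    ‖v‖ ≤ ‖Ehat‖ * ‖ContinuousLinearMap.adjoint E v‖ := by
  have h : ContinuousLinearMap.adjoint Ehat (ContinuousLinearMap.adjoint E v) = v := by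
    refine ext_inner_right ℝ fun w => ?_
    rw [ContinuousLinearMap.adjoint_inner_left, ContinuousLinearMap.adjoint_inner_left, hright]
  calc ‖v‖ = ‖ContinuousLinearMap.adjoint Ehat (ContinuousLinearMap.adjoint E v)‖ := by rw [h]
    _ ≤ ‖ContinuousLinearMap.adjoint Ehat‖ * ‖ContinuousLinearMap.adjoint E v‖ :=
      ContinuousLinearMap.le_opNorm _ _
    _ = ‖Ehat‖ * ‖ContinuousLinearMap.adjoint E v‖ := by rw [LinearIsometryEquiv.norm_map]

/-- If `E` has a bounded right inverse, then `E ∘ E†` is coercive. -/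
lemma norm_sq_le_mul_inner_comp_adjoint_of_rightInverse
    (hright : ∀ v : H, E (Ehat v) = v) (v : H) :
    ‖v‖ ^ 2 ≤ ‖Ehat‖ ^ 2 * inner ℝ (E (ContinuousLinearMap.adjoint E v)) v := by
  rw [← ContinuousLinearMap.adjoint_inner_right, real_inner_self_eq_norm_sq, ← mul_pow]
  exact pow_le_pow_left₀ (norm_nonneg v) (norm_le_mul_norm_adjoint_of_rightInverse hright v) 2

/-- If `E` has a bounded right inverse, then `E ∘ E†` is bounded below. -/
lemma norm_le_mul_norm_comp_adjoint_of_rightInverse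
    (hright : ∀ v : H, E (Ehat v) = v) (v : H) :
    ‖v‖ ≤ ‖Ehat‖ ^ 2 * ‖E (ContinuousLinearMap.adjoint E v)‖ := by
  rcases (norm_nonneg v).eq_or_lt with h0 | h0
  · rw [← h0]
    positivity
  · refine le_of_mul_le_mul_right ?_ h0
    calc ‖v‖ * ‖v‖ = ‖v‖ ^ 2 := (sq _).symm
      _ ≤ ‖Ehat‖ ^ 2 * inner ℝ (E (ContinuousLinearMap.adjoint E v)) v :=
        norm_sq_le_mul_inner_comp_adjoint_of_rightInverse hright v
      _ ≤ ‖Ehat‖ ^ 2 * (‖E (ContinuousLinearMap.adjoint E v)‖ * ‖v‖) := by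
        gcongr
        exact real_inner_le_norm _ _
      _ = ‖Ehat‖ ^ 2 * ‖E (ContinuousLinearMap.adjoint E v)‖ * ‖v‖ := (mul_assoc _ _ _).symm

/-- If `E` has a bounded right inverse, then `E ∘ E†` is invertible. -/
lemma isUnit_comp_adjoint_of_rightInverse (hright : ∀ v : H, E (Ehat v) = v) :
    IsUnit (E ∘L ContinuousLinearMap.adjoint E) := by
  have hc : (0 : NNReal) < (‖Ehat‖₊ ^ 2 + 1)⁻¹ := by positivity
  refine ContinuousLinearMap.isUnit_of_forall_le_norm_inner_map _ hc fun v => ?_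
  have h := norm_sq_le_mul_inner_comp_adjoint_of_rightInverse hright v
  have habs := le_abs_self (inner ℝ (E (ContinuousLinearMap.adjoint E v)) v)
  have hnn := abs_nonneg (inner ℝ (E (ContinuousLinearMap.adjoint E v)) v)
  push_cast
  rw [← div_eq_mul_inv, div_le_iff₀ (by positivity), Real.norm_eq_abs, Function.comp_apply]
  nlinarith [mul_le_mul_of_nonneg_left habs (sq_nonneg ‖Ehat‖)]

end RightInverse

/-- If `E : G → H` has a bounded right inverse `Ê`, then `E ∘ E†` is
bijective and its condition number satisfies
`‖E ∘ E†‖ · ‖(E ∘ E†)⁻¹‖ ≤ ‖E‖² · ‖Ê‖²` (the inverse expressed as any bounded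
two-sided inverse `S` of `E ∘ E†`). -/
theorem stmt5
    {G H : Type*}
    [NormedAddCommGroup G] [InnerProductSpace ℝ G] [CompleteSpace G]
    [NormedAddCommGroup H] [InnerProductSpace ℝ H] [CompleteSpace H]
    (E : G →L[ℝ] H) (Ehat : H →L[ℝ] G)
    (hright : ∀ v : H, E (Ehat v) = v) :
    Function.Bijective (fun v : H => E (ContinuousLinearMap.adjoint E v)) ∧
      ∀ S : H →L[ℝ] H,
        (∀ v : H, S (E (ContinuousLinearMap.adjoint E v)) = v) →
        (∀ v : H, E (ContinuousLinearMap.adjoint E (S v)) = v) →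
        ‖E ∘L ContinuousLinearMap.adjoint E‖ * ‖S‖ ≤ ‖E‖ ^ 2 * ‖Ehat‖ ^ 2 := by
  refine ⟨?_, fun S _ hS => ?_⟩
  · exact ContinuousLinearMap.isUnit_iff_bijective.mp (isUnit_comp_adjoint_of_rightInverse hright)
  · have hE : ‖E ∘L ContinuousLinearMap.adjoint E‖ ≤ ‖E‖ ^ 2 := by
      refine (ContinuousLinearMap.opNorm_comp_le _ _).trans_eq ?_
      rw [LinearIsometryEquiv.norm_map, sq]
    have hSn : ‖S‖ ≤ ‖Ehat‖ ^ 2 := by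
      refine S.opNorm_le_bound (by positivity) fun w => ?_
      simpa only [hS] using norm_le_mul_norm_comp_adjoint_of_rightInverse hright (S w)
    exact mul_le_mul hE hSn (norm_nonneg _) (by positivity)
end

section
/- Let Ĝ be a real Hilbert space and C : Ĝ → Ĝ a bounded self-adjoint operator such that m‖x‖² ≤ ⟪C x, x⟫ ≤ M‖x‖² for all x ∈ Ĝ, where 0 < m ≤ M. Then for every pair of vectors x, y ∈ Ĝ with ⟪x, y⟫ = 0, one has ⟪x, C y⟫² ≤ ((M − m)/(M + m))² · ‖x‖² · ‖C y‖². -/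
open scoped InnerProductSpace

/-- A symmetric operator whose quadratic form lies between `0` and `K` satisfies `A² ≤ K A`. -/
theorem LinearMap.IsSymmetric.norm_sq_apply_le_mul_inner
    {E : Type*} [NormedAddCommGroup E] [InnerProductSpace ℝ E]
    {A : E →ₗ[ℝ] E} (hA : A.IsSymmetric) {K : ℝ} (hK : 0 ≤ K)
    (hlow : ∀ x : E, 0 ≤ ⟪A x, x⟫_ℝ) (hhigh : ∀ x : E, ⟪A x, x⟫_ℝ ≤ K * ‖x‖ ^ 2) (y : E) :
    ‖A y‖ ^ 2 ≤ K * ⟪A y, y⟫_ℝ := by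
  have expand (s : ℝ) : 0 ≤ ⟪A y, y⟫_ℝ - 2 * s * ‖A y‖ ^ 2 + s ^ 2 * (K * ‖A y‖ ^ 2) := by
    have h := hlow (y - s • A y)
    simp only [map_sub, map_smul, inner_sub_left, inner_sub_right, real_inner_smul_left,
      real_inner_smul_right, hA (A y) y, real_inner_self_eq_norm_sq] at h
    nlinarith [mul_le_mul_of_nonneg_left (hhigh (A y)) (sq_nonneg s)]
  rcases hK.eq_or_lt with rfl | hK
  · have h := expand 1
    have h' := hhigh y
    linarith
  · have h := mul_nonneg hK.le (expand K⁻¹)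
    field_simp at h
    linarith

/-- If `m ≤ C ≤ M` as quadratic forms, then `(C - m)(M - C)` is nonnegative. -/
theorem LinearMap.IsSymmetric.norm_sq_apply_add_le_mul_inner
    {E : Type*} [NormedAddCommGroup E] [InnerProductSpace ℝ E]
    {C : E →ₗ[ℝ] E} (hC : C.IsSymmetric) {m M : ℝ} (hmM : m ≤ M)
    (hlow : ∀ x : E, m * ‖x‖ ^ 2 ≤ ⟪C x, x⟫_ℝ)
    (hhigh : ∀ x : E, ⟪C x, x⟫_ℝ ≤ M * ‖x‖ ^ 2) (y : E) :
    ‖C y‖ ^ 2 + m * M * ‖y‖ ^ 2 ≤ (M + m) * ⟪C y, y⟫_ℝ := by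
  have form (x : E) : ⟪(C - m • LinearMap.id : E →ₗ[ℝ] E) x, x⟫_ℝ = ⟪C x, x⟫_ℝ - m * ‖x‖ ^ 2 := by
    simp [inner_sub_left, real_inner_smul_left]
  have hA : (C - m • LinearMap.id).IsSymmetric := fun u v => by
    simp [inner_sub_left, inner_sub_right, real_inner_smul_left, real_inner_smul_right,
      ← hC u v]
  have h := hA.norm_sq_apply_le_mul_inner (sub_nonneg.2 hmM)
    (fun x => by linarith [form x, hlow x]) (fun x => by linarith [form x, hhigh x]) y
  rw [form] at h
  simp only [LinearMap.sub_apply, LinearMap.smul_apply, LinearMap.id_apply, norm_sub_sq_real,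
    real_inner_smul_right, norm_smul, mul_pow, Real.norm_eq_abs, sq_abs] at h
  linarith

/-- a consequence of the Wielandt inequality: If `C` is a bounded
self-adjoint operator on a real Hilbert space with `m ‖x‖² ≤ ⟪C x, x⟫ ≤ M ‖x‖²` for
`0 < m ≤ M`, then for all orthogonal vectors `x ⊥ y` one has
`⟪x, C y⟫² ≤ ((M − m)/(M + m))² ‖x‖² ‖C y‖²`. -/
theorem stmt13
    {Ghat : Type*}
    [NormedAddCommGroup Ghat] [InnerProductSpace ℝ Ghat] [CompleteSpace Ghat]
    (C : Ghat →L[ℝ] Ghat) (hCsa : IsSelfAdjoint C)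
    (m M : ℝ) (hm : 0 < m) (hmM : m ≤ M)
    (hlow : ∀ x : Ghat, m * ‖x‖ ^ 2 ≤ ⟪C x, x⟫_ℝ)
    (hhigh : ∀ x : Ghat, ⟪C x, x⟫_ℝ ≤ M * ‖x‖ ^ 2) :
    ∀ x y : Ghat, ⟪x, y⟫_ℝ = 0 →
      ⟪x, C y⟫_ℝ ^ 2 ≤ ((M - m) / (M + m)) ^ 2 * ‖x‖ ^ 2 * ‖C y‖ ^ 2 := by
  intro x y hxy
  have hsum : 0 < M + m := by linarith
  have key := hCsa.isSymmetric.norm_sq_apply_add_le_mul_inner hmM hlow hhigh y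
  simp only [ContinuousLinearMap.coe_coe] at key
  set t : ℝ := 2 * m * M / (M + m) with ht
  have hshift : ⟪x, C y⟫_ℝ = ⟪x, C y - t • y⟫_ℝ := by
    simp [inner_sub_right, real_inner_smul_right, hxy]
  have hnorm : ‖C y - t • y‖ ^ 2 ≤ ((M - m) / (M + m)) ^ 2 * ‖C y‖ ^ 2 := by
    have hc : 0 ≤ 4 * m * M / (M + m) ^ 2 := by
      have : 0 < M := by linarith
      positivity
    have h := mul_le_mul_of_nonneg_left key hc
    have hid : ‖C y - t • y‖ ^ 2 - ((M - m) / (M + m)) ^ 2 * ‖C y‖ ^ 2 =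
        4 * m * M / (M + m) ^ 2 * (‖C y‖ ^ 2 + m * M * ‖y‖ ^ 2) -
          4 * m * M / (M + m) ^ 2 * ((M + m) * ⟪C y, y⟫_ℝ) := by
      rw [norm_sub_sq_real, real_inner_smul_right, norm_smul, mul_pow, Real.norm_eq_abs, sq_abs,
        ht]
      field_simp
      ring
    linarith
  calc ⟪x, C y⟫_ℝ ^ 2 ≤ (‖x‖ * ‖C y - t • y‖) ^ 2 := by
        rw [hshift]
        exact sq_le_sq.2 ((abs_real_inner_le_norm _ _).trans (le_abs_self _))
    _ = ‖x‖ ^ 2 * ‖C y - t • y‖ ^ 2 := mul_pow _ _ _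
    _ ≤ ‖x‖ ^ 2 * (((M - m) / (M + m)) ^ 2 * ‖C y‖ ^ 2) := by gcongr
    _ = ((M - m) / (M + m)) ^ 2 * ‖x‖ ^ 2 * ‖C y‖ ^ 2 := by ring
end

section
/- Let H be a real Hilbert space, ι a finite index set, and for each ℓ ∈ ι let G_ℓ be a real Hilbert space and E_ℓ : G_ℓ → H a bounded linear operator. Assume the stable decomposition property: there is C_E > 0 such that every v ∈ H admits a family (v_ℓ)_{ℓ∈ι} with v_ℓ ∈ G_ℓ, Σ_ℓ E_ℓ v_ℓ = v, and Σ_ℓ ‖v_ℓ‖² ≤ C_E² ‖v‖². Assume also there is ρ > 0 such that ‖Σ_ℓ E_ℓ w_ℓ‖² ≤ ρ · Σ_ℓ ‖w_ℓ‖² for every family (w_ℓ) with w_ℓ ∈ G_ℓ. Then the additive operator P := Σ_ℓ E_ℓ ∘ E_ℓ† : H → H satisfies, for every u ∈ H, C_E^{-2} ‖u‖² ≤ ⟪P u, u⟫ ≤ ρ ‖u‖². -/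
open scoped InnerProductSpace

theorem two_mul_real_inner_le_inv_mul_add_mul {F : Type*} [NormedAddCommGroup F]
    [InnerProductSpace ℝ F] {c : ℝ} (hc : 0 < c) (x y : F) :
    2 * ⟪x, y⟫_ℝ ≤ c⁻¹ * ‖x‖ ^ 2 + c * ‖y‖ ^ 2 := by
  have hxy := real_inner_le_norm x y
  have hsq : c⁻¹ * (‖x‖ - c * ‖y‖) ^ 2 =
      c⁻¹ * ‖x‖ ^ 2 + c * ‖y‖ ^ 2 - 2 * (‖x‖ * ‖y‖) := by
    field_simp
    ring
  have : 0 ≤ c⁻¹ * (‖x‖ - c * ‖y‖) ^ 2 := by positivity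
  linarith

/-- abstract additive Schwarz bounds: Let `H` be a real Hilbert space,
`ι` a finite index set, and `E_ℓ : G_ℓ → H` bounded operators from real Hilbert spaces
`G_ℓ`. Assume the stable decomposition property with constant `C_E > 0` and the bound
`‖Σ_ℓ E_ℓ w_ℓ‖² ≤ ρ Σ_ℓ ‖w_ℓ‖²` with `ρ > 0`. Then the additive operator
`P u = Σ_ℓ E_ℓ (E_ℓ† u)` satisfies `C_E⁻² ‖u‖² ≤ ⟪P u, u⟫ ≤ ρ ‖u‖²`. -/
theorem stmt17
    {H : Type*} [NormedAddCommGroup H] [InnerProductSpace ℝ H] [CompleteSpace H]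
    {ι : Type*} [Fintype ι]
    {G : ι → Type*}
    [∀ ℓ, NormedAddCommGroup (G ℓ)] [∀ ℓ, InnerProductSpace ℝ (G ℓ)]
    [∀ ℓ, CompleteSpace (G ℓ)]
    (E : ∀ ℓ, G ℓ →L[ℝ] H)
    (CE : ℝ) (hCE : 0 < CE)
    (hstable : ∀ v : H, ∃ w : ∀ ℓ, G ℓ,
      (∑ ℓ, E ℓ (w ℓ)) = v ∧ (∑ ℓ, ‖w ℓ‖ ^ 2) ≤ CE ^ 2 * ‖v‖ ^ 2)
    (ρ : ℝ) (hρ : 0 < ρ)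
    (hbound : ∀ w : ∀ ℓ, G ℓ, ‖∑ ℓ, E ℓ (w ℓ)‖ ^ 2 ≤ ρ * ∑ ℓ, ‖w ℓ‖ ^ 2) :
    ∀ u : H,
      CE⁻¹ ^ 2 * ‖u‖ ^ 2 ≤ ⟪∑ ℓ, E ℓ (ContinuousLinearMap.adjoint (E ℓ) u), u⟫_ℝ ∧
      ⟪∑ ℓ, E ℓ (ContinuousLinearMap.adjoint (E ℓ) u), u⟫_ℝ ≤ ρ * ‖u‖ ^ 2 := by
  intro u
  have hinner (w : ∀ ℓ, G ℓ) :
      ⟪∑ ℓ, E ℓ (w ℓ), u⟫_ℝ = ∑ ℓ, ⟪w ℓ, ContinuousLinearMap.adjoint (E ℓ) u⟫_ℝ := by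
    simp_rw [sum_inner, ContinuousLinearMap.adjoint_inner_right]
  have henergy : ⟪∑ ℓ, E ℓ (ContinuousLinearMap.adjoint (E ℓ) u), u⟫_ℝ =
      ∑ ℓ, ‖ContinuousLinearMap.adjoint (E ℓ) u‖ ^ 2 := by
    simp_rw [hinner, real_inner_self_eq_norm_sq]
  constructor
  · obtain ⟨w, hw, hw_norm⟩ := hstable u
    have hyoung : 2 * ‖u‖ ^ 2 ≤ (CE ^ 2)⁻¹ * ∑ ℓ, ‖w ℓ‖ ^ 2 +
        CE ^ 2 * ∑ ℓ, ‖ContinuousLinearMap.adjoint (E ℓ) u‖ ^ 2 := by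
      rw [← real_inner_self_eq_norm_sq u]
      nth_rewrite 1 [← hw]
      rw [hinner, Finset.mul_sum, Finset.mul_sum, Finset.mul_sum, ← Finset.sum_add_distrib]
      exact Finset.sum_le_sum fun ℓ _ =>
        two_mul_real_inner_le_inv_mul_add_mul (by positivity) _ _
    have hdecomp : (CE ^ 2)⁻¹ * ∑ ℓ, ‖w ℓ‖ ^ 2 ≤ ‖u‖ ^ 2 :=
      (inv_mul_le_iff₀ (by positivity)).2 hw_norm
    rw [henergy, inv_pow, inv_mul_le_iff₀ (by positivity)]
    linarith
  · have hyoung := two_mul_real_inner_le_inv_mul_add_mul hρ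
      (∑ ℓ, E ℓ (ContinuousLinearMap.adjoint (E ℓ) u)) u
    have hP := (inv_mul_le_iff₀ hρ).2 (hbound fun ℓ => ContinuousLinearMap.adjoint (E ℓ) u)
    rw [← henergy] at hP
    linarith
end

section
/- Let H and Ĝ be real Hilbert spaces, R : H → Ĝ a bounded linear operator, and C : Ĝ → Ĝ a bounded self-adjoint operator with ⟪C x, x⟫ ≥ 0 for all x; define c(u,v) := ⟪C u, v⟫. Suppose F̂ : H → Ĝ is a bounded linear operator such that R†(C(F̂ u)) = u for all u ∈ H, and let K > 0 satisfy c(F̂ w, F̂ w) ≤ K² ‖w‖² for all w ∈ H. Then for every w ∈ H, ‖R w‖² ≤ ‖R‖² · K² · c(R w, R w); i.e. the constant r₁ in the equivalence b(ψ,ψ) ≤ r₁² c(ψ,ψ) on the range of R can be bounded by r₁ ≤ ‖R‖ · K. -/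
open scoped InnerProductSpace

/-- bound on the constant `r₁`: Let `R : H → Ĝ` be bounded, `C` a bounded
self-adjoint positive-semidefinite operator defining `c(u,v) = ⟪C u, v⟫`, and suppose
`F̂ : H → Ĝ` satisfies `R†(C(F̂ u)) = u` for all `u` (i.e. `F̂` is a right inverse of the
`c`-transpose of `R`) and is `c`-stable: `c(F̂ w, F̂ w) ≤ K² ‖w‖²` with `K > 0`. Then
`‖R w‖² ≤ ‖R‖² K² c(R w, R w)` for all `w ∈ H`. -/
theorem stmt19
    {H Ghat : Type*}
    [NormedAddCommGroup H] [InnerProductSpace ℝ H] [CompleteSpace H]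
    [NormedAddCommGroup Ghat] [InnerProductSpace ℝ Ghat] [CompleteSpace Ghat]
    (R : H →L[ℝ] Ghat)
    (C : Ghat →L[ℝ] Ghat) (hCsa : IsSelfAdjoint C)
    (hCpos : ∀ x : Ghat, 0 ≤ ⟪C x, x⟫_ℝ)
    (Fhat : H →L[ℝ] Ghat)
    (hFhat : ∀ u : H, ContinuousLinearMap.adjoint R (C (Fhat u)) = u)
    (K : ℝ) (hK : 0 < K)
    (hKstable : ∀ w : H, ⟪C (Fhat w), Fhat w⟫_ℝ ≤ K ^ 2 * ‖w‖ ^ 2) :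
    ∀ w : H, ‖R w‖ ^ 2 ≤ ‖R‖ ^ 2 * K ^ 2 * ⟪C (R w), R w⟫_ℝ := by
  intro w
  have hFR : ⟪C (Fhat w), R w⟫_ℝ = ‖w‖ ^ 2 := by
    rw [← ContinuousLinearMap.adjoint_inner_left, hFhat, real_inner_self_eq_norm_sq]
  have hRF : ⟪C (R w), Fhat w⟫_ℝ = ‖w‖ ^ 2 := by
    rw [← hFR, real_inner_comm (R w)]
    exact (hCsa.isSymmetric (R w) (Fhat w))
  -- Positivity of `c` at `Fhat w - K ^ 2 • R w` gives the bound without Cauchy-Schwarz.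
  have hw : ‖w‖ ^ 2 ≤ K ^ 2 * ⟪C (R w), R w⟫_ℝ := by
    have hpos := hCpos (Fhat w - K ^ 2 • R w)
    simp only [map_sub, map_smul, inner_sub_left, inner_sub_right, real_inner_smul_left,
      real_inner_smul_right, hFR, hRF] at hpos
    have hst := hKstable w
    refine le_of_mul_le_mul_left ?_ (pow_pos hK 2)
    linarith
  calc ‖R w‖ ^ 2 ≤ (‖R‖ * ‖w‖) ^ 2 := by gcongr; exact R.le_opNorm w
    _ = ‖R‖ ^ 2 * ‖w‖ ^ 2 := mul_pow _ _ _
    _ ≤ ‖R‖ ^ 2 * (K ^ 2 * ⟪C (R w), R w⟫_ℝ) := by gcongr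
    _ = ‖R‖ ^ 2 * K ^ 2 * ⟪C (R w), R w⟫_ℝ := (mul_assoc _ _ _).symm
end
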